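/- Let A, B ∈ ℂ^{n₁×n₁×n₃} with A† = A and B† = B (each tensor equals its own Moore–Penrose inverse), let k = max{ind(A), ind(B)}, and let A^{GD}, B^{GD} be GD inverses of A and B satisfying the GD equations with exponent k. If A ⋆ B = B ⋆ A and B^{GD} ⋆ B ⋆ A = A ⋆ B^{GD} ⋆ B, then the GDMP inverse of A ⋆ B built from the GD inverse A^{GD} ⋆ B^{GD} satisfies (A⋆B)^{GD,†} = A^{GD,†} ⋆ B^{GD,†}, i.e., (A^{GD}⋆B^{GD}) ⋆ (A⋆B) ⋆ (A⋆B)† = (A^{GD}⋆A⋆A†) ⋆ (B^{GD}⋆B⋆B†). -/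

import Mathlib

open Matrix BigOperators

/-- A third-order complex tensor in `ℂ^{n₁ × n₂ × n₃}`, given by its frontal slices. -/
abbrev Tensor3 (n₁ n₂ n₃ : ℕ) := Fin n₃ → Matrix (Fin n₁) (Fin n₂) ℂ

/-- Mode-3 product of a tensor with an `n₃ × n₃` matrix: the slices of the result are the
indicated linear combinations of the slices of `A`. -/
noncomputable def mode3 {n₁ n₂ n₃ : ℕ} (M : Matrix (Fin n₃) (Fin n₃) ℂ) (A : Tensor3 n₁ n₂ n₃) :
    Tensor3 n₁ n₂ n₃ :=
  fun i => ∑ j, M i j • A j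

/-- The M-product `A ⋆_M B`: slice-wise matrix product in the transformed (hat) domain,
transformed back by `M⁻¹`. -/
noncomputable def mprod {n₁ n₂ l n₃ : ℕ} (M : Matrix (Fin n₃) (Fin n₃) ℂ)
    (A : Tensor3 n₁ n₂ n₃) (B : Tensor3 n₂ l n₃) : Tensor3 n₁ l n₃ :=
  mode3 M⁻¹ (fun i => mode3 M A i * mode3 M B i)

/-- The identity tensor: every slice of its mode-3 transform is the identity matrix. -/
noncomputable def idT (n₁ : ℕ) {n₃ : ℕ} (M : Matrix (Fin n₃) (Fin n₃) ℂ) : Tensor3 n₁ n₁ n₃ :=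
  mode3 M⁻¹ (fun _ => (1 : Matrix (Fin n₁) (Fin n₁) ℂ))

/-- Powers of a square tensor with respect to the M-product. -/
noncomputable def mpow {n₁ n₃ : ℕ} (M : Matrix (Fin n₃) (Fin n₃) ℂ) (A : Tensor3 n₁ n₁ n₃) :
    ℕ → Tensor3 n₁ n₁ n₃
  | 0 => idT n₁ M
  | k + 1 => mprod M (mpow M A k) A

/-- Conjugate transpose with respect to the M-product: slice-wise conjugate transpose in the
transformed domain. -/
noncomputable def ctrans {n₁ n₂ n₃ : ℕ} (M : Matrix (Fin n₃) (Fin n₃) ℂ) (A : Tensor3 n₁ n₂ n₃) :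
    Tensor3 n₂ n₁ n₃ :=
  mode3 M⁻¹ (fun i => (mode3 M A i)ᴴ)

/-- Index of a square complex matrix: the least `k ≥ 0` with `rank(B^k) = rank(B^{k+1})`. -/
noncomputable def matIndex {n : ℕ} (B : Matrix (Fin n) (Fin n) ℂ) : ℕ :=
  sInf {k : ℕ | (B ^ k).rank = (B ^ (k + 1)).rank}

/-- Index of a tensor: the maximum of the indices of the slices of its mode-3 transform. -/
noncomputable def tIndex {n₁ n₃ : ℕ} (M : Matrix (Fin n₃) (Fin n₃) ℂ)
    (A : Tensor3 n₁ n₁ n₃) : ℕ :=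
  Finset.univ.sup fun i => matIndex (mode3 M A i)

/-- `X` is a GD inverse of `A` with exponent `k`:
`A ⋆ X ⋆ A = A`, `X ⋆ A^{k+1} = A^k`, `A^{k+1} ⋆ X = A^k`. -/
def IsGD {n₁ n₃ : ℕ} (M : Matrix (Fin n₃) (Fin n₃) ℂ) (A X : Tensor3 n₁ n₁ n₃)
    (k : ℕ) : Prop :=
  mprod M (mprod M A X) A = A ∧
  mprod M X (mpow M A (k + 1)) = mpow M A k ∧
  mprod M (mpow M A (k + 1)) X = mpow M A k

/-- `X` is the Drazin inverse of `A` with exponent `k`. -/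
def IsDrazin {n₁ n₃ : ℕ} (M : Matrix (Fin n₃) (Fin n₃) ℂ) (A X : Tensor3 n₁ n₁ n₃)
    (k : ℕ) : Prop :=
  mprod M X (mpow M A (k + 1)) = mpow M A k ∧
  mprod M (mprod M X A) X = X ∧
  mprod M X A = mprod M A X

/-- `X` is the Moore–Penrose inverse of `A`. -/
def IsMP {n₁ n₃ : ℕ} (M : Matrix (Fin n₃) (Fin n₃) ℂ) (A X : Tensor3 n₁ n₁ n₃) : Prop :=
  mprod M (mprod M A X) A = A ∧
  mprod M (mprod M X A) X = X ∧
  ctrans M (mprod M A X) = mprod M A X ∧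
  ctrans M (mprod M X A) = mprod M X A

section Monoid

variable {R : Type*} [Monoid R]

/-- If `a * a * a = a`, an element that cancels one factor from some power `a ^ (k + 1)` on the
left already does so for `a * a`. -/
theorem mul_sq_of_mul_pow_succ {a x : R} (ha : a * a * a = a) {k : ℕ}
    (hx : x * a ^ (k + 1) = a ^ k) : x * (a * a) = a := by
  have odd_pow : ∀ m : ℕ, a ^ (2 * m + 1) = a := by
    intro m
    induction m with
    | zero => simp
    | succ m ih =>
      rw [show 2 * (m + 1) + 1 = (2 * m + 1) + 1 + 1 by ring, pow_succ, pow_succ, ih, ha]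
  have h : x * a ^ (2 * k + 2) = a ^ (2 * k + 1) := by
    rw [show 2 * k + 2 = (k + 1) + (k + 1) by ring, show 2 * k + 1 = k + (k + 1) by ring,
      pow_add, ← mul_assoc, hx, ← pow_add]
  rwa [show 2 * k + 2 = (2 * k + 1) + 1 by ring, pow_succ, odd_pow] at h

variable [StarMul R]

/-- Uniqueness of the Moore–Penrose inverse in a monoid with involution. -/
theorem moorePenrose_unique {c x y : R}
    (hx₁ : c * x * c = c) (hx₂ : x * c * x = x) (hx₃ : star (c * x) = c * x)
    (hx₄ : star (x * c) = x * c)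
    (hy₁ : c * y * c = c) (hy₂ : y * c * y = y) (hy₃ : star (c * y) = c * y)
    (hy₄ : star (y * c) = y * c) : x = y := by
  have hl : c * x = c * y := by
    calc c * x = star (c * y * c * x) := by rw [hy₁, hx₃]
      _ = star (c * x) * star (c * y) := by rw [← star_mul, ← mul_assoc]
      _ = c * x * c * y := by rw [hx₃, hy₃, ← mul_assoc]
      _ = c * y := by rw [hx₁]
  have hr : x * c = y * c := by
    calc x * c = star (x * (c * y * c)) := by rw [hy₁, hx₄]
      _ = star (y * c) * star (x * c) := by rw [← star_mul]; simp only [mul_assoc]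
      _ = y * (c * x * c) := by rw [hx₄, hy₄]; simp only [mul_assoc]
      _ = y * c := by rw [hx₁]
  rw [← hx₂, mul_assoc, hl, ← mul_assoc, hr, hy₂]

/-- The forward order law for two commuting elements that are their own Moore–Penrose inverses. -/
theorem forward_order_law_of_commute {a b x y d : R} {k : ℕ} (hab : Commute a b)
    (ha : a * a * a = a) (has : star (a * a) = a * a)
    (hb : b * b * b = b) (hbs : star (b * b) = b * b)
    (hx : x * a ^ (k + 1) = a ^ k) (hy : y * b ^ (k + 1) = b ^ k)
    (hd₁ : a * b * d * (a * b) = a * b) (hd₂ : d * (a * b) * d = d)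
    (hd₃ : star (a * b * d) = a * b * d) (hd₄ : star (d * (a * b)) = d * (a * b)) :
    x * y * (a * b) * d = x * a * a * (y * b * b) := by
  have hsq' : a * b * (a * b) = a * a * (b * b) := hab.symm.mul_mul_mul_comm a b
  have hsq : a * b * (a * b) = b * b * (a * a) := by
    rw [hsq', ((hab.mul_left hab).mul_right (hab.mul_left hab)).eq]
  have hcube : a * b * (a * b) * (a * b) = a * b := by
    rw [hsq', (hab.mul_right hab).symm.mul_mul_mul_comm, ha, hb]
  have hstar : star (a * b * (a * b)) = a * b * (a * b) := by
    rw [hsq, star_mul, has, hbs, ← hsq', hsq]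
  obtain rfl : d = a * b :=
    moorePenrose_unique hd₁ hd₂ hd₃ hd₄ hcube hcube hstar hstar
  have hxa := mul_sq_of_mul_pow_succ ha hx
  have hyb := mul_sq_of_mul_pow_succ hb hy
  calc x * y * (a * b) * (a * b) = x * (y * (b * b)) * (a * a) := by
        rw [mul_assoc (x * y), hsq]; simp only [mul_assoc]
    _ = x * (a * a) * b := by
        rw [hyb, mul_assoc, ← (hab.mul_left hab).eq, mul_assoc x (a * a)]
    _ = x * a * a * (y * b * b) := by rw [mul_assoc x a a, mul_assoc y b b, hyb]

end Monoid

section Transform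

variable {n₁ n₂ n₃ : ℕ} {M : Matrix (Fin n₃) (Fin n₃) ℂ}

theorem mode3_mode3 (M N : Matrix (Fin n₃) (Fin n₃) ℂ) (A : Tensor3 n₁ n₂ n₃) :
    mode3 M (mode3 N A) = mode3 (M * N) A := by
  funext i
  simp only [mode3, Matrix.mul_apply, Finset.smul_sum, Finset.sum_smul, smul_smul]
  exact Finset.sum_comm

theorem mode3_one (A : Tensor3 n₁ n₂ n₃) : mode3 1 A = A := by
  funext i
  simp [mode3, Matrix.one_apply, ite_smul]

theorem mode3_mode3_inv (hM : IsUnit M) (A : Tensor3 n₁ n₂ n₃) :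
    mode3 M (mode3 M⁻¹ A) = A := by
  rw [mode3_mode3, Matrix.mul_nonsing_inv _ ((Matrix.isUnit_iff_isUnit_det M).mp hM), mode3_one]

theorem mode3_injective (hM : IsUnit M) :
    Function.Injective (mode3 M : Tensor3 n₁ n₂ n₃ → Tensor3 n₁ n₂ n₃) := by
  refine Function.LeftInverse.injective (g := mode3 M⁻¹) fun A => ?_
  rw [mode3_mode3, Matrix.nonsing_inv_mul _ ((Matrix.isUnit_iff_isUnit_det M).mp hM), mode3_one]

theorem mode3_mprod (hM : IsUnit M) (A B : Tensor3 n₁ n₁ n₃) :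
    mode3 M (mprod M A B) = mode3 M A * mode3 M B :=
  mode3_mode3_inv hM _

theorem mode3_ctrans (hM : IsUnit M) (A : Tensor3 n₁ n₁ n₃) :
    mode3 M (ctrans M A) = star (mode3 M A) :=
  mode3_mode3_inv hM _

theorem mode3_mpow (hM : IsUnit M) (A : Tensor3 n₁ n₁ n₃) (k : ℕ) :
    mode3 M (mpow M A k) = mode3 M A ^ k := by
  induction k with
  | zero => exact mode3_mode3_inv hM _
  | succ k ih => rw [mpow, mode3_mprod hM, ih, pow_succ]

end Transform

/-- forward order law for the GDMP inverse of involutory-MP tensors. -/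
theorem gdmp_forward_order_law {n₁ n₃ : ℕ} (hn₁ : 0 < n₁) (hn₃ : 0 < n₃)
    (M : Matrix (Fin n₃) (Fin n₃) ℂ) (hM : IsUnit M)
    (A B AGD BGD Adag Bdag ABdag : Tensor3 n₁ n₁ n₃) (k : ℕ)
    (hAdag : IsMP M A Adag) (hAA : Adag = A)
    (hBdag : IsMP M B Bdag) (hBB : Bdag = B)
    (hk : k = max (tIndex M A) (tIndex M B))
    (hAGD : IsGD M A AGD k) (hBGD : IsGD M B BGD k)
    (hcomm : mprod M A B = mprod M B A)
    (h1 : mprod M (mprod M BGD B) A = mprod M (mprod M A BGD) B)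
    (hABdag : IsMP M (mprod M A B) ABdag) :
    mprod M (mprod M (mprod M AGD BGD) (mprod M A B)) ABdag =
      mprod M (mprod M (mprod M AGD A) Adag) (mprod M (mprod M BGD B) Bdag) := by
  subst Adag Bdag
  have transform {X Y : Tensor3 n₁ n₁ n₃} (h : X = Y) : mode3 M X = mode3 M Y := congrArg _ h
  obtain ⟨ha, -, has, -⟩ := hAdag
  obtain ⟨hb, -, hbs, -⟩ := hBdag
  obtain ⟨-, hx, -⟩ := hAGD
  obtain ⟨-, hy, -⟩ := hBGD
  obtain ⟨hd₁, hd₂, hd₃, hd₄⟩ := hABdag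
  replace ha := transform ha
  replace has := transform has
  replace hb := transform hb
  replace hbs := transform hbs
  replace hx := transform hx
  replace hy := transform hy
  replace hcomm := transform hcomm
  replace hd₁ := transform hd₁
  replace hd₂ := transform hd₂
  replace hd₃ := transform hd₃
  replace hd₄ := transform hd₄
  apply mode3_injective hM
  simp only [mode3_mprod hM, mode3_ctrans hM, mode3_mpow hM] at *
  exact forward_order_law_of_commute hcomm ha has hb hbs hx hy hd₁ hd₂ hd₃ hd₄
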